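/- Let B be a finitely generated skew brace. If B is annihilator hypercentral, then B is annihilator nilpotent, i.e. B = Ann_n(B) for some positive integer n. -/

import Mathlib

universe u v

/-- A skew (left) brace: two group structures `(B,+)` and `(B,∘)` on the same set,
sharing the same identity element `zero` (recall that in any skew brace `0 = 1`),
satisfying the skew left distributive law `a ∘ (b + c) = a ∘ b - a + a ∘ c`. -/
structure SkewBrace (B : Type u) where
  add : B → B → B
  zero : B
  neg : B → B
  mul : B → B → B
  inv : B → B
  add_assoc : ∀ a b c, add (add a b) c = add a (add b c)
  zero_add : ∀ a, add zero a = a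
  add_zero : ∀ a, add a zero = a
  neg_add : ∀ a, add (neg a) a = zero
  add_neg : ∀ a, add a (neg a) = zero
  mul_assoc : ∀ a b c, mul (mul a b) c = mul a (mul b c)
  zero_mul : ∀ a, mul zero a = a
  mul_zero : ∀ a, mul a zero = a
  inv_mul : ∀ a, mul (inv a) a = zero
  mul_inv : ∀ a, mul a (inv a) = zero
  compat : ∀ a b c, mul a (add b c) = add (add (mul a b) (neg a)) (mul a c)

namespace SkewBrace

variable {B C Q : Type u}

/-- `λ_a (b) = -a + a ∘ b`. -/
def lam (S : SkewBrace B) (a b : B) : B := S.add (S.neg a) (S.mul a b)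

/-- `a ∗ b = λ_a(b) - b = -a + a ∘ b - b`. -/
def star (S : SkewBrace B) (a b : B) : B := S.add (S.lam a b) (S.neg b)

/-- A sub-skew brace: a subset containing the identity and closed under both group
operations and both inverses. -/
def IsSub (S : SkewBrace B) (T : Set B) : Prop :=
  S.zero ∈ T ∧ (∀ a ∈ T, ∀ b ∈ T, S.add a b ∈ T) ∧ (∀ a ∈ T, S.neg a ∈ T) ∧
    (∀ a ∈ T, ∀ b ∈ T, S.mul a b ∈ T) ∧ (∀ a ∈ T, S.inv a ∈ T)

/-- The sub-skew brace generated by a subset. -/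
def subGen (S : SkewBrace B) (X : Set B) : Set B := ⋂₀ {T | S.IsSub T ∧ X ⊆ T}

/-- A skew brace is finitely generated if a finite subset generates it. -/
def FinitelyGenerated (S : SkewBrace B) : Prop := ∃ T : Finset B, S.subGen ↑T = Set.univ

/-- A subgroup of the additive group `(B,+)`. -/
def IsAddSubgroup (S : SkewBrace B) (T : Set B) : Prop :=
  S.zero ∈ T ∧ (∀ a ∈ T, ∀ b ∈ T, S.add a b ∈ T) ∧ ∀ a ∈ T, S.neg a ∈ T

/-- A subgroup of the multiplicative group `(B,∘)`. -/
def IsMulSubgroup (S : SkewBrace B) (T : Set B) : Prop :=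
  S.zero ∈ T ∧ (∀ a ∈ T, ∀ b ∈ T, S.mul a b ∈ T) ∧ ∀ a ∈ T, S.inv a ∈ T

/-- The additive subgroup generated by a subset. -/
def addClosure (S : SkewBrace B) (X : Set B) : Set B := ⋂₀ {T | S.IsAddSubgroup T ∧ X ⊆ T}

/-- The multiplicative subgroup generated by a subset. -/
def mulClosure (S : SkewBrace B) (X : Set B) : Set B := ⋂₀ {T | S.IsMulSubgroup T ∧ X ⊆ T}

/-- The group `(B,+)` is finitely generated. -/
def AddFG (S : SkewBrace B) : Prop := ∃ T : Finset B, S.addClosure ↑T = Set.univ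

/-- The group `(B,∘)` is finitely generated. -/
def MulFG (S : SkewBrace B) : Prop := ∃ T : Finset B, S.mulClosure ↑T = Set.univ

/-- An ideal of a skew brace: a subgroup of `(B,+)`, normal in `(B,+)` and in `(B,∘)`,
invariant under all the maps `λ_b`. -/
def IsIdeal (S : SkewBrace B) (I : Set B) : Prop :=
  S.IsAddSubgroup I ∧ (∀ b : B, ∀ a ∈ I, S.add (S.add b a) (S.neg b) ∈ I) ∧
    (∀ b : B, ∀ a ∈ I, S.mul (S.mul b a) (S.inv b) ∈ I) ∧
    ∀ b : B, ∀ a ∈ I, S.lam b a ∈ I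

/-- The ideal generated by a subset (the smallest ideal containing it). -/
def idealGen (S : SkewBrace B) (X : Set B) : Set B := ⋂₀ {I | S.IsIdeal I ∧ X ⊆ I}

/-- A homomorphism of skew braces. -/
def IsHom (S : SkewBrace B) (T : SkewBrace C) (f : B → C) : Prop :=
  (∀ a b, f (S.add a b) = T.add (f a) (f b)) ∧ ∀ a b, f (S.mul a b) = T.mul (f a) (f b)

/-- `SF` together with `ι : X → F` is the free skew brace on `X`: every map from `X`
to a skew brace extends uniquely to a homomorphism. -/
def IsFreeOn {F : Type u} {X : Type v} (SF : SkewBrace F) (ι : X → F) : Prop :=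
  ∀ (C : Type u) (SC : SkewBrace C) (f : X → C),
    ∃! g : F → C, IsHom SF SC g ∧ ∀ x, g (ι x) = f x

/-- A skew brace is finitely presented if it is the image of a free skew brace on a
finite set under a homomorphism whose kernel is generated, as an ideal, by finitely
many elements. -/
def FinitelyPresented (S : SkewBrace B) : Prop :=
  ∃ (F : Type u) (SF : SkewBrace F) (m : ℕ) (ι : Fin m → F) (θ : F → B),
    IsFreeOn SF ι ∧ IsHom SF S θ ∧ Function.Surjective θ ∧
      ∃ R : Finset F, {x | θ x = S.zero} = SF.idealGen ↑R

/-- `π : B → Q` realizes `Q` as the quotient skew brace `B/I`. -/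
def IsQuotientBy (S : SkewBrace B) (I : Set B) (SQ : SkewBrace Q) (π : B → Q) : Prop :=
  IsHom S SQ π ∧ Function.Surjective π ∧ {x | π x = SQ.zero} = I

/-- The group `(B,+)` is finitely presented (as an abstract group). -/
def AddFP (S : SkewBrace B) : Prop :=
  ∃ (m : ℕ) (f : FreeGroup (Fin m) → B),
    (∀ x y, f (x * y) = S.add (f x) (f y)) ∧ Function.Surjective f ∧
      ∃ R : Finset (FreeGroup (Fin m)),
        {x | f x = S.zero} = ↑(Subgroup.normalClosure (R : Set (FreeGroup (Fin m))))

/-- The group `(B,∘)` is finitely presented (as an abstract group). -/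
def MulFP (S : SkewBrace B) : Prop :=
  ∃ (m : ℕ) (f : FreeGroup (Fin m) → B),
    (∀ x y, f (x * y) = S.mul (f x) (f y)) ∧ Function.Surjective f ∧
      ∃ R : Finset (FreeGroup (Fin m)),
        {x | f x = S.zero} = ↑(Subgroup.normalClosure (R : Set (FreeGroup (Fin m))))

/-- The ascending chain condition on sub-skew braces. -/
def SubACC (S : SkewBrace B) : Prop :=
  ∀ f : ℕ → Set B, Monotone f → (∀ n, S.IsSub (f n)) → ∃ n, ∀ m, n ≤ m → f m = f n

/-- The ascending chain condition on subgroups of `(B,+)`. -/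
def AddACC (S : SkewBrace B) : Prop :=
  ∀ f : ℕ → Set B, Monotone f → (∀ n, S.IsAddSubgroup (f n)) → ∃ n, ∀ m, n ≤ m → f m = f n

/-- The socle `Soc(B) = Ker(λ) ∩ Z(B,+)`. -/
def soc (S : SkewBrace B) : Set B :=
  {x | (∀ b, S.lam x b = b) ∧ ∀ b, S.add x b = S.add b x}

/-- The centre of the additive group `(B,+)`. -/
def addCenter (S : SkewBrace B) : Set B := {x | ∀ b, S.add x b = S.add b x}

/-- The preimage in `B` of `Ann(B/I)` (for `I` an ideal): the set of `x` such that,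
modulo `I`, `λ_x = id`, `x` is central in `(B,+)` and `x` is central in `(B,∘)`. -/
def annStep (S : SkewBrace B) (I : Set B) : Set B :=
  {x | (∀ b, S.add (S.lam x b) (S.neg b) ∈ I) ∧
       (∀ b, S.add (S.add x b) (S.neg (S.add b x)) ∈ I) ∧
       ∀ b, S.mul (S.mul x b) (S.inv (S.mul b x)) ∈ I}

/-- The preimage in `B` of `Soc(B/I)` (for `I` an ideal). -/
def socStep (S : SkewBrace B) (I : Set B) : Set B :=
  {x | (∀ b, S.add (S.lam x b) (S.neg b) ∈ I) ∧
       ∀ b, S.add (S.add x b) (S.neg (S.add b x)) ∈ I}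

/-- The upper annihilator series `Ann_α(B)`, defined by transfinite recursion. -/
noncomputable def annSeries (S : SkewBrace B) (o : Ordinal.{v}) : Set B :=
  Ordinal.limitRecOn o {S.zero} (fun _ ih => S.annStep ih)
    fun _o _ ih => ⋃ β, ⋃ h : β < _o, ih β h

/-- The upper socle series `Soc_α(B)`, defined by transfinite recursion. -/
noncomputable def socSeries (S : SkewBrace B) (o : Ordinal.{v}) : Set B :=
  Ordinal.limitRecOn o {S.zero} (fun _ ih => S.socStep ih)
    fun _o _ ih => ⋃ β, ⋃ h : β < _o, ih β h

/-- The solution of the YBE associated with a skew brace: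
`r_B(a,b) = (λ_a(b), λ_a(b)⁻¹ ∘ a ∘ b)`. -/
def braceR (S : SkewBrace B) : B × B → B × B :=
  fun p => (S.lam p.1 p.2, S.mul (S.inv (S.lam p.1 p.2)) (S.mul p.1 p.2))

end SkewBrace

/-- The set-theoretic Yang–Baxter (braid) equation
`(r × id)(id × r)(r × id) = (id × r)(r × id)(id × r)`. -/
def ybe {X : Type u} (r : X × X → X × X) : Prop :=
  let r₁ : X × X × X → X × X × X := fun p =>
    ((r (p.1, p.2.1)).1, (r (p.1, p.2.1)).2, p.2.2)
  let r₂ : X × X × X → X × X × X := fun p => (p.1, r p.2)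
  r₁ ∘ r₂ ∘ r₁ = r₂ ∘ r₁ ∘ r₂

/-- A non-degenerate set-theoretic solution: `r` is bijective, satisfies the YBE, and
writing `r (x,y) = (σ_x y, τ_y x)`, all maps `σ_x` and `τ_y` are bijective. -/
def IsNonDegenerateSolution {X : Type u} (r : X × X → X × X) : Prop :=
  Function.Bijective r ∧ ybe r ∧
    (∀ x, Function.Bijective fun y => (r (x, y)).1) ∧
    ∀ y, Function.Bijective fun x => (r (x, y)).2

/-- `S` (with the distinguished map `ι : X → B`) is the structure skew brace of the
solution `(X,r)`: the multiplicative group of `S` is the structure group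
`G(X,r) = ⟨X | x y = σ_x(y) τ_y(x)⟩` (expressed by the relations holding together
with the universal property of the presentation) and `r_S ∘ (ι × ι) = (ι × ι) ∘ r`. -/
def IsStructureSkewBrace {X B : Type u} (r : X × X → X × X)
    (S : SkewBrace B) (ι : X → B) : Prop :=
  (∀ x y, S.mul (ι x) (ι y) = S.mul (ι (r (x, y)).1) (ι (r (x, y)).2)) ∧
  (∀ (H : Type u) [Group H] (f : X → H),
      (∀ x y, f x * f y = f (r (x, y)).1 * f (r (x, y)).2) →
      ∃! φ : B → H, (∀ a b, φ (S.mul a b) = φ a * φ b) ∧ ∀ x, φ (ι x) = f x) ∧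
  ∀ x y, S.braceR (ι x, ι y) = (ι (r (x, y)).1, ι (r (x, y)).2)

namespace SkewBrace

section Arithmetic

variable {B : Type u} (S : SkewBrace B)

attribute [local simp] add_assoc zero_add add_zero neg_add add_neg mul_assoc zero_mul mul_zero
  inv_mul mul_inv

theorem neg_add_cancel_left (a b : B) : S.add (S.neg a) (S.add a b) = b := by
  rw [← S.add_assoc]; simp

theorem add_neg_cancel_left (a b : B) : S.add a (S.add (S.neg a) b) = b := by
  rw [← S.add_assoc]; simp

theorem inv_mul_cancel_left (a b : B) : S.mul (S.inv a) (S.mul a b) = b := by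
  rw [← S.mul_assoc]; simp

theorem mul_inv_cancel_left (a b : B) : S.mul a (S.mul (S.inv a) b) = b := by
  rw [← S.mul_assoc]; simp

attribute [local simp] neg_add_cancel_left add_neg_cancel_left inv_mul_cancel_left
  mul_inv_cancel_left

theorem eq_neg_of_add_eq_zero {a b : B} (h : S.add a b = S.zero) : b = S.neg a := by
  rw [← S.neg_add_cancel_left a b, h, S.add_zero]

theorem eq_inv_of_mul_eq_zero {a b : B} (h : S.mul a b = S.zero) : b = S.inv a := by
  rw [← S.inv_mul_cancel_left a b, h, S.mul_zero]

theorem neg_neg (a : B) : S.neg (S.neg a) = a := (S.eq_neg_of_add_eq_zero (by simp)).symm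

theorem inv_inv (a : B) : S.inv (S.inv a) = a := (S.eq_inv_of_mul_eq_zero (by simp)).symm

theorem neg_zero : S.neg S.zero = S.zero := (S.eq_neg_of_add_eq_zero (by simp)).symm

theorem inv_zero : S.inv S.zero = S.zero := (S.eq_inv_of_mul_eq_zero (by simp)).symm

theorem neg_add_rev (a b : B) : S.neg (S.add a b) = S.add (S.neg b) (S.neg a) :=
  (S.eq_neg_of_add_eq_zero (by simp)).symm

theorem mul_inv_rev (a b : B) : S.inv (S.mul a b) = S.mul (S.inv b) (S.inv a) :=
  (S.eq_inv_of_mul_eq_zero (by simp)).symm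

attribute [local simp] neg_neg inv_inv neg_zero inv_zero neg_add_rev mul_inv_rev

theorem add_neg_eq_zero_iff {a b : B} : S.add a (S.neg b) = S.zero ↔ a = b := by
  refine ⟨fun h => ?_, fun h => by simp [h]⟩
  have := congrArg (fun t => S.add t b) h
  simpa using this

theorem mul_inv_eq_zero_iff {a b : B} : S.mul a (S.inv b) = S.zero ↔ a = b := by
  refine ⟨fun h => ?_, fun h => by simp [h]⟩
  have := congrArg (fun t => S.mul t b) h
  simpa using this

theorem add_lam (a b : B) : S.add a (S.lam a b) = S.mul a b := by simp [lam]

theorem lam_add (a b c : B) : S.lam a (S.add b c) = S.add (S.lam a b) (S.lam a c) := by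
  simp [lam, compat]

theorem zero_lam (b : B) : S.lam S.zero b = b := by simp [lam]

theorem lam_zero (a : B) : S.lam a S.zero = S.zero := by simp [lam]

theorem lam_neg (a b : B) : S.lam a (S.neg b) = S.neg (S.lam a b) :=
  S.eq_neg_of_add_eq_zero (by rw [← lam_add]; simp [lam_zero])

theorem mul_lam (a b c : B) : S.lam (S.mul a b) c = S.lam a (S.lam b c) := by
  rw [show S.lam b c = S.add (S.neg b) (S.mul b c) from rfl, lam_add, lam_neg]
  simp [lam]

theorem inv_lam_lam (a b : B) : S.lam (S.inv a) (S.lam a b) = b := by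
  rw [← mul_lam, inv_mul, zero_lam]

theorem lam_inv_lam (a b : B) : S.lam a (S.lam (S.inv a) b) = b := by
  rw [← mul_lam, mul_inv, zero_lam]

theorem mul_inv_lam (a b : B) : S.mul a (S.lam (S.inv a) b) = S.add a b := by
  rw [← add_lam, lam_inv_lam]

theorem inv_eq_neg_lam (a : B) : S.inv a = S.neg (S.lam (S.inv a) a) := by simp [lam]

theorem inv_mul_eq_lam (a b : B) :
    S.mul (S.inv a) b = S.lam (S.inv a) (S.add (S.neg a) b) := by
  rw [lam_add, lam_neg, ← inv_eq_neg_lam, add_lam]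

theorem lam_inv_mul (a b : B) : S.lam a (S.mul (S.inv a) b) = S.add (S.neg a) b := by
  rw [inv_mul_eq_lam, lam_inv_lam]

/-- The additive commutator `-a - b + a + b`. -/
def addComm (a b : B) : B := S.add (S.add (S.neg a) (S.neg b)) (S.add a b)

theorem add_addComm (a b : B) :
    S.add a (S.addComm a b) = S.add (S.neg b) (S.add a b) := by simp [addComm]

theorem addComm_eq_zero_iff {a b : B} : S.addComm a b = S.zero ↔ S.add a b = S.add b a := by
  constructor
  · intro h
    have := congrArg (fun t => S.add b (S.add a t)) h
    simpa [addComm] using this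
  · intro h
    simp [addComm, h]

theorem star_eq_zero_iff {a b : B} : S.star a b = S.zero ↔ S.lam a b = b :=
  S.add_neg_eq_zero_iff

theorem star_add (a b : B) : S.add (S.star a b) b = S.lam a b := by simp [star]

/-- Elements `a`, `b` on which all of `λ` and both commutators are trivial. -/
def Centralizes (a b : B) : Prop :=
  S.lam a b = b ∧ S.lam b a = a ∧ S.mul a b = S.mul b a

variable {S}

theorem Centralizes.symm {a b : B} (h : S.Centralizes a b) : S.Centralizes b a :=
  ⟨h.2.1, h.1, h.2.2.symm⟩

theorem Centralizes.mul_eq_add {a b : B} (h : S.Centralizes a b) : S.mul a b = S.add a b := by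
  rw [← add_lam, h.1]

theorem Centralizes.add_comm {a b : B} (h : S.Centralizes a b) : S.add a b = S.add b a := by
  rw [← h.mul_eq_add, h.2.2, h.symm.mul_eq_add]

theorem centralizes_of_add_comm {a b : B} (hab : S.lam a b = b) (hba : S.lam b a = a)
    (h : S.add a b = S.add b a) : S.Centralizes a b :=
  ⟨hab, hba, by rw [← add_lam, ← add_lam, hab, hba, h]⟩

theorem centralizes_zero (a : B) : S.Centralizes a S.zero := by
  simp [Centralizes, lam_zero, zero_lam]

theorem Centralizes.mul {a b c : B} (hb : S.Centralizes a b) (hc : S.Centralizes a c) :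
    S.Centralizes a (S.mul b c) := by
  refine ⟨?_, ?_, ?_⟩
  · rw [← S.add_lam b c, lam_add, hb.1, ← mul_lam, hb.2.2, mul_lam, hc.1]
  · rw [mul_lam, hc.2.1, hb.2.1]
  · rw [← S.mul_assoc, hb.2.2, S.mul_assoc, hc.2.2, S.mul_assoc]

theorem Centralizes.inv {a b : B} (h : S.Centralizes a b) : S.Centralizes a (S.inv b) := by
  have hcomm : S.mul a (S.inv b) = S.mul (S.inv b) a := by
    rw [← S.inv_mul_cancel_left b (S.mul a (S.inv b)), ← S.mul_assoc b, ← h.2.2]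
    simp
  refine ⟨?_, ?_, hcomm⟩
  · rw [S.inv_eq_neg_lam b, lam_neg, ← mul_lam, hcomm, mul_lam, h.1]
  · conv_lhs => rw [← h.2.1]
    rw [inv_lam_lam]

theorem isMulSubgroup_centralizes (a : B) : S.IsMulSubgroup {b | S.Centralizes a b} :=
  ⟨centralizes_zero a, fun _ hb _ hc => hb.mul hc, fun _ hb => hb.inv⟩

variable (S)

/-- The annihilator `Ann(B)`. -/
def ann : Set B := {a | ∀ b, S.Centralizes a b}

variable {S}

theorem inv_mem_ann {a : B} (ha : a ∈ S.ann) : S.inv a ∈ S.ann :=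
  fun b => (ha b).symm.inv.symm

theorem isIdeal_ann : S.IsIdeal S.ann := by
  refine ⟨⟨fun b => (centralizes_zero b).symm, fun a ha b hb => ?_, fun a ha => ?_⟩,
    fun b a ha => ?_, fun b a ha => ?_, fun b a ha => ?_⟩
  · rw [← (ha b).mul_eq_add]
    exact fun c => ((ha c).symm.mul (hb c).symm).symm
  · have : S.neg a = S.inv a :=
      S.eq_inv_of_mul_eq_zero (by rw [(ha _).mul_eq_add, S.add_neg])
    exact this ▸ inv_mem_ann ha
  · rw [← (ha b).add_comm]
    simpa using ha
  · rw [← (ha b).2.2]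
    simpa using ha
  · rw [(ha b).2.1]
    exact ha

end Arithmetic

section Quotient

variable {B : Type u} {S : SkewBrace B} {I : Set B}

attribute [local simp] add_assoc zero_add add_zero neg_add add_neg mul_assoc zero_mul mul_zero
  inv_mul mul_inv neg_add_cancel_left add_neg_cancel_left inv_mul_cancel_left
  mul_inv_cancel_left neg_neg inv_inv neg_zero inv_zero neg_add_rev mul_inv_rev

theorem IsIdeal.mul_mem (hI : S.IsIdeal I) {a b : B} (ha : a ∈ I) (hb : b ∈ I) :
    S.mul a b ∈ I :=
  S.add_lam a b ▸ hI.1.2.1 _ ha _ (hI.2.2.2 a b hb)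

theorem IsIdeal.inv_mem (hI : S.IsIdeal I) {a : B} (ha : a ∈ I) : S.inv a ∈ I :=
  S.inv_eq_neg_lam a ▸ hI.1.2.2 _ (hI.2.2.2 _ a ha)

theorem IsIdeal.isSub (hI : S.IsIdeal I) : S.IsSub I :=
  ⟨hI.1.1, hI.1.2.1, hI.1.2.2, fun _ ha _ hb => hI.mul_mem ha hb, fun _ ha => hI.inv_mem ha⟩

theorem IsIdeal.neg_add_mem_iff (hI : S.IsIdeal I) {a b : B} :
    S.add (S.neg a) b ∈ I ↔ S.mul (S.inv a) b ∈ I :=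
  ⟨fun h => S.inv_mul_eq_lam a b ▸ hI.2.2.2 _ _ h, fun h => S.lam_inv_mul a b ▸ hI.2.2.2 _ _ h⟩

/-- Congruence modulo an ideal. -/
def IsIdeal.setoid (hI : S.IsIdeal I) : Setoid B where
  r a b := S.add (S.neg a) b ∈ I
  iseqv :=
    { refl := fun a => by simpa using hI.1.1
      symm := fun {a b} h => by simpa using hI.1.2.2 _ h
      trans := fun {a b c} h h' => by simpa using hI.1.2.1 _ h _ h' }

theorem IsIdeal.add_congr (hI : S.IsIdeal I) {a a' b b' : B} (ha : S.add (S.neg a) a' ∈ I)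
    (hb : S.add (S.neg b) b' ∈ I) : S.add (S.neg (S.add a b)) (S.add a' b') ∈ I := by
  simpa using hI.1.2.1 _ (hI.2.1 (S.neg b) _ ha) _ hb

theorem IsIdeal.neg_congr (hI : S.IsIdeal I) {a a' : B} (ha : S.add (S.neg a) a' ∈ I) :
    S.add (S.neg (S.neg a)) (S.neg a') ∈ I := by
  simpa using hI.2.1 a _ (hI.1.2.2 _ ha)

theorem IsIdeal.mul_congr (hI : S.IsIdeal I) {a a' b b' : B} (ha : S.add (S.neg a) a' ∈ I)
    (hb : S.add (S.neg b) b' ∈ I) : S.add (S.neg (S.mul a b)) (S.mul a' b') ∈ I := by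
  rw [hI.neg_add_mem_iff] at *
  simpa using hI.mul_mem (hI.2.2.1 (S.inv b) _ ha) hb

theorem IsIdeal.inv_congr (hI : S.IsIdeal I) {a a' : B} (ha : S.add (S.neg a) a' ∈ I) :
    S.add (S.neg (S.inv a)) (S.inv a') ∈ I := by
  rw [hI.neg_add_mem_iff] at *
  simpa using hI.2.2.1 a _ (hI.inv_mem ha)

/-- The quotient of a skew brace by an ideal. -/
def IsIdeal.quotient (hI : S.IsIdeal I) : SkewBrace (Quotient hI.setoid) where
  add := Quotient.map₂ S.add fun _ _ ha _ _ hb => hI.add_congr ha hb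
  zero := Quotient.mk _ S.zero
  neg := Quotient.map S.neg fun _ _ ha => hI.neg_congr ha
  mul := Quotient.map₂ S.mul fun _ _ ha _ _ hb => hI.mul_congr ha hb
  inv := Quotient.map S.inv fun _ _ ha => hI.inv_congr ha
  add_assoc := by
    rintro ⟨a⟩ ⟨b⟩ ⟨c⟩
    exact congrArg (Quotient.mk _) (S.add_assoc a b c)
  zero_add := by
    rintro ⟨a⟩
    exact congrArg (Quotient.mk _) (S.zero_add a)
  add_zero := by
    rintro ⟨a⟩
    exact congrArg (Quotient.mk _) (S.add_zero a)
  neg_add := by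
    rintro ⟨a⟩
    exact congrArg (Quotient.mk _) (S.neg_add a)
  add_neg := by
    rintro ⟨a⟩
    exact congrArg (Quotient.mk _) (S.add_neg a)
  mul_assoc := by
    rintro ⟨a⟩ ⟨b⟩ ⟨c⟩
    exact congrArg (Quotient.mk _) (S.mul_assoc a b c)
  zero_mul := by
    rintro ⟨a⟩
    exact congrArg (Quotient.mk _) (S.zero_mul a)
  mul_zero := by
    rintro ⟨a⟩
    exact congrArg (Quotient.mk _) (S.mul_zero a)
  inv_mul := by
    rintro ⟨a⟩
    exact congrArg (Quotient.mk _) (S.inv_mul a)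
  mul_inv := by
    rintro ⟨a⟩
    exact congrArg (Quotient.mk _) (S.mul_inv a)
  compat := by
    rintro ⟨a⟩ ⟨b⟩ ⟨c⟩
    exact congrArg (Quotient.mk _) (S.compat a b c)

/-- The projection onto the quotient by an ideal. -/
def IsIdeal.mk (hI : S.IsIdeal I) (a : B) : Quotient hI.setoid := Quotient.mk _ a

theorem IsIdeal.mk_surjective (hI : S.IsIdeal I) : Function.Surjective hI.mk :=
  Quotient.mk_surjective

theorem IsIdeal.mk_eq_zero (hI : S.IsIdeal I) {a : B} :
    hI.mk a = hI.quotient.zero ↔ a ∈ I := by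
  refine Iff.trans (eq_comm.trans Quotient.eq) ?_
  change S.add (S.neg S.zero) a ∈ I ↔ a ∈ I
  simp

theorem IsIdeal.centralizes_mk_iff (hI : S.IsIdeal I) {a b : B} :
    hI.quotient.Centralizes (hI.mk a) (hI.mk b) ↔
      S.star a b ∈ I ∧ S.star b a ∈ I ∧ S.addComm a b ∈ I := by
  rw [← hI.mk_eq_zero, ← hI.mk_eq_zero, ← hI.mk_eq_zero]
  change _ ↔ hI.quotient.star (hI.mk a) (hI.mk b) = _ ∧ hI.quotient.star (hI.mk b) (hI.mk a) = _ ∧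
    hI.quotient.addComm (hI.mk a) (hI.mk b) = _
  rw [star_eq_zero_iff, star_eq_zero_iff, addComm_eq_zero_iff]
  exact ⟨fun h => ⟨h.1, h.2.1, h.add_comm⟩, fun h => centralizes_of_add_comm h.1 h.2.1 h.2.2⟩

theorem IsIdeal.mem_annStep_iff (hI : S.IsIdeal I) {a : B} :
    a ∈ S.annStep I ↔ hI.mk a ∈ hI.quotient.ann := by
  have key : a ∈ S.annStep I ↔ ∀ b, hI.quotient.lam (hI.mk a) b = b ∧
      hI.quotient.add (hI.mk a) b = hI.quotient.add b (hI.mk a) ∧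
      hI.quotient.mul (hI.mk a) b = hI.quotient.mul b (hI.mk a) := by
    simp only [hI.mk_surjective.forall, forall_and]
    refine and_congr (forall_congr' fun b => ?_) <|
      and_congr (forall_congr' fun b => ?_) (forall_congr' fun b => ?_)
    · rw [← hI.quotient.add_neg_eq_zero_iff]
      exact hI.mk_eq_zero.symm
    · rw [← hI.quotient.add_neg_eq_zero_iff]
      exact hI.mk_eq_zero.symm
    · rw [← hI.quotient.mul_inv_eq_zero_iff]
      exact hI.mk_eq_zero.symm
  rw [key]
  refine forall_congr' fun b => ⟨fun h => ⟨h.1, ?_, h.2.2⟩, fun h => ⟨h.1, h.add_comm, h.2.2⟩⟩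
  rw [lam, ← h.2.2, ← add_lam, h.1, h.2.1, neg_add_cancel_left]

theorem IsIdeal.annStep (hI : S.IsIdeal I) : S.IsIdeal (S.annStep I) := by
  have hJ : hI.quotient.IsIdeal hI.quotient.ann := isIdeal_ann
  have h : S.annStep I = hI.mk ⁻¹' hI.quotient.ann := Set.ext fun _ => hI.mem_annStep_iff
  rw [h]
  exact ⟨⟨hJ.1.1, fun a ha b hb => hJ.1.2.1 _ ha _ hb, fun a ha => hJ.1.2.2 _ ha⟩,
    fun b a ha => hJ.2.1 (hI.mk b) _ ha, fun b a ha => hJ.2.2.1 (hI.mk b) _ ha,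
    fun b a ha => hJ.2.2.2 (hI.mk b) _ ha⟩

theorem IsIdeal.subset_annStep (hI : S.IsIdeal I) : I ⊆ S.annStep I := by
  intro a ha
  rw [hI.mem_annStep_iff, hI.mk_eq_zero.2 ha]
  exact isIdeal_ann.1.1

theorem IsIdeal.centralizes_of_mem_annStep (hI : S.IsIdeal I) {a : B} (ha : a ∈ S.annStep I)
    (b : B) : S.star a b ∈ I ∧ S.star b a ∈ I ∧ S.addComm a b ∈ I :=
  hI.centralizes_mk_iff.1 (hI.mem_annStep_iff.1 ha (hI.mk b))

theorem mulClosure_subset {X T : Set B} (hT : S.IsMulSubgroup T) (h : X ⊆ T) :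
    S.mulClosure X ⊆ T :=
  Set.sInter_subset_of_mem ⟨hT, h⟩

/-- Being in the annihilator modulo an ideal can be tested on a generating set of `(B,∘)`. -/
theorem IsIdeal.mem_annStep_of_mulClosure_eq_univ (hI : S.IsIdeal I) {C : Set B}
    (hC : S.mulClosure C = Set.univ) {a : B}
    (h : ∀ c ∈ C, S.star a c ∈ I ∧ S.star c a ∈ I ∧ S.addComm a c ∈ I) : a ∈ S.annStep I := by
  have hT := isMulSubgroup_centralizes (S := hI.quotient) (hI.mk a)
  have hT' : S.IsMulSubgroup {b | hI.quotient.Centralizes (hI.mk a) (hI.mk b)} :=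
    ⟨hT.1, fun b hb c hc => hT.2.1 _ hb _ hc, fun b hb => hT.2.2 _ hb⟩
  have hsub := mulClosure_subset hT' fun c hc => hI.centralizes_mk_iff.2 (h c hc)
  rw [hI.mem_annStep_iff]
  intro q
  obtain ⟨b, rfl⟩ := hI.mk_surjective q
  exact hsub (hC ▸ Set.mem_univ b)

end Quotient

section Series

variable {B : Type u} (S : SkewBrace B)

theorem annSeries_zero : S.annSeries (0 : Ordinal.{v}) = {S.zero} :=
  Ordinal.limitRecOn_zero ..

theorem annSeries_add_one (o : Ordinal.{v}) :
    S.annSeries (o + 1) = S.annStep (S.annSeries o) :=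
  Ordinal.limitRecOn_add_one ..

theorem annSeries_limit {o : Ordinal.{v}} (ho : Order.IsSuccLimit o) :
    S.annSeries o = ⋃ β, ⋃ _ : β < o, S.annSeries β :=
  Ordinal.limitRecOn_limit _ _ _ _ ho

theorem isIdeal_zero : S.IsIdeal {S.zero} := by
  simp [IsIdeal, IsAddSubgroup, S.add_zero, S.add_neg, S.mul_zero, S.mul_inv, S.neg_zero, lam_zero]

theorem isIdeal_annSeries_and_subset (o : Ordinal.{v}) :
    S.IsIdeal (S.annSeries o) ∧ ∀ β ≤ o, S.annSeries β ⊆ S.annSeries o := by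
  induction o using Ordinal.limitRecOn with
  | zero =>
    refine ⟨S.annSeries_zero ▸ S.isIdeal_zero, fun β hβ => ?_⟩
    rw [nonpos_iff_eq_zero.1 hβ]
  | add_one o ih =>
    rw [annSeries_add_one]
    refine ⟨ih.1.annStep, fun β hβ => ?_⟩
    rcases hβ.lt_or_eq with h | rfl
    · exact (ih.2 β (Order.lt_add_one_iff.1 h)).trans ih.1.subset_annStep
    · rw [annSeries_add_one]
  | limit o ho ih =>
    have hmem : ∀ x, x ∈ S.annSeries o ↔ ∃ β < o, x ∈ S.annSeries β := by
      simp [S.annSeries_limit ho]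
    refine ⟨⟨⟨?_, fun a ha b hb => ?_, fun a ha => ?_⟩, fun b a ha => ?_, fun b a ha => ?_,
      fun b a ha => ?_⟩, fun β hβ => ?_⟩
    · exact (hmem _).2 ⟨0, ho.bot_lt, (ih 0 ho.bot_lt).1.1.1⟩
    · obtain ⟨β, hβ, ha⟩ := (hmem _).1 ha
      obtain ⟨γ, hγ, hb⟩ := (hmem _).1 hb
      have hm := max_lt hβ hγ
      exact (hmem _).2 ⟨_, hm, (ih _ hm).1.1.2.1 _ ((ih _ hm).2 _ (le_max_left _ _) ha) _
        ((ih _ hm).2 _ (le_max_right _ _) hb)⟩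
    · obtain ⟨β, hβ, ha⟩ := (hmem _).1 ha
      exact (hmem _).2 ⟨β, hβ, (ih β hβ).1.1.2.2 _ ha⟩
    · obtain ⟨β, hβ, ha⟩ := (hmem _).1 ha
      exact (hmem _).2 ⟨β, hβ, (ih β hβ).1.2.1 _ _ ha⟩
    · obtain ⟨β, hβ, ha⟩ := (hmem _).1 ha
      exact (hmem _).2 ⟨β, hβ, (ih β hβ).1.2.2.1 _ _ ha⟩
    · obtain ⟨β, hβ, ha⟩ := (hmem _).1 ha
      exact (hmem _).2 ⟨β, hβ, (ih β hβ).1.2.2.2 _ _ ha⟩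
    · rcases hβ.lt_or_eq with h | rfl
      · exact fun x hx => (hmem x).2 ⟨β, h, hx⟩
      · exact subset_rfl

theorem isIdeal_annSeries (o : Ordinal.{v}) : S.IsIdeal (S.annSeries o) :=
  (S.isIdeal_annSeries_and_subset o).1

theorem annSeries_mono {α β : Ordinal.{v}} (h : α ≤ β) : S.annSeries α ⊆ S.annSeries β :=
  (S.isIdeal_annSeries_and_subset β).2 α h

/-- The least ordinal whose term of the upper annihilator series contains `a`. -/
noncomputable def annRank (a : B) : Ordinal.{v} := sInf {o | a ∈ S.annSeries o}

variable {S}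

theorem annRank_le {a : B} {o : Ordinal.{v}} (h : a ∈ S.annSeries o) : S.annRank a ≤ o :=
  csInf_le' h

theorem mem_annSeries_annRank {o : Ordinal.{v}} (ho : S.annSeries o = Set.univ) (a : B) :
    a ∈ S.annSeries (S.annRank a : Ordinal.{v}) :=
  csInf_mem (s := {o : Ordinal.{v} | a ∈ S.annSeries o}) ⟨o, ho.symm.subset (Set.mem_univ a)⟩

theorem eq_zero_or_exists_mem_annStep {o : Ordinal.{v}} (ho : S.annSeries o = Set.univ) (a : B) :
    a = S.zero ∨ ∃ β : Ordinal.{v}, β < S.annRank a ∧ a ∈ S.annStep (S.annSeries β) := by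
  have ha := mem_annSeries_annRank ho a
  rcases Ordinal.zero_or_succ_or_isSuccLimit (S.annRank a : Ordinal.{v}) with h | ⟨β, h⟩ | h
  · rw [h, annSeries_zero] at ha
    exact Or.inl ha
  · rw [← h, Order.succ_eq_add_one, annSeries_add_one] at ha
    exact Or.inr ⟨β, h ▸ Order.lt_succ β, ha⟩
  · rw [annSeries_limit _ h] at ha
    obtain ⟨β, hβ, hx⟩ := Set.mem_iUnion₂.1 ha
    exact absurd (annRank_le hx) hβ.not_ge

/-- `B` together with a rank function that strictly decreases under taking commutators. -/
def IsCommutatorRank (S : SkewBrace B) (ρ : B → Ordinal.{v}) : Prop :=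
  ∀ a b, (∀ x, x = S.star a b ∨ x = S.star (S.inv a) b ∨ x = S.addComm a b →
    x = S.zero ∨ (ρ x < ρ a ∧ ρ x < ρ b))

theorem isCommutatorRank_annRank {o : Ordinal.{v}} (ho : S.annSeries o = Set.univ) :
    S.IsCommutatorRank (S.annRank : B → Ordinal.{v}) := by
  intro a b x hx
  have hleft : x = S.zero ∨ S.annRank x < (S.annRank a : Ordinal.{v}) := by
    rcases eq_zero_or_exists_mem_annStep ho a with rfl | ⟨β, hβ, ha⟩
    · left
      rcases hx with rfl | rfl | rfl
      · rw [star_eq_zero_iff, zero_lam]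
      · rw [star_eq_zero_iff, inv_zero, zero_lam]
      · rw [addComm_eq_zero_iff, S.zero_add, S.add_zero]
    · right
      have hI := S.isIdeal_annSeries β
      refine lt_of_le_of_lt (annRank_le ?_) hβ
      rcases hx with rfl | rfl | rfl
      · exact (hI.centralizes_of_mem_annStep ha b).1
      · exact (hI.centralizes_of_mem_annStep (hI.annStep.inv_mem ha) b).1
      · exact (hI.centralizes_of_mem_annStep ha b).2.2
  have hright : x = S.zero ∨ S.annRank x < (S.annRank b : Ordinal.{v}) := by
    rcases eq_zero_or_exists_mem_annStep ho b with rfl | ⟨β, hβ, hb⟩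
    · left
      rcases hx with rfl | rfl | rfl
      · rw [star_eq_zero_iff, lam_zero]
      · rw [star_eq_zero_iff, lam_zero]
      · rw [addComm_eq_zero_iff, S.zero_add, S.add_zero]
    · right
      have hI := S.isIdeal_annSeries β
      refine lt_of_le_of_lt (annRank_le ?_) hβ
      rcases hx with rfl | rfl | rfl
      · exact (hI.centralizes_of_mem_annStep hb a).2.1
      · exact (hI.centralizes_of_mem_annStep hb (S.inv a)).2.1
      · rw [← hI.mk_eq_zero]
        change hI.quotient.addComm (hI.mk a) (hI.mk b) = _
        rw [addComm_eq_zero_iff]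
        exact (hI.mem_annStep_iff.1 hb (hI.mk a)).add_comm.symm
  tauto

end Series

section Closure

/-- A finite set has finite closure under a finitely valued binary operation all of whose
values other than `z` strictly decrease along a well-founded relation. -/
theorem exists_finset_closed {α : Type*} {r : α → α → Prop} (hr : WellFounded r)
    (f : α → α → Finset α) (z : α) (h : ∀ x y, ∀ w ∈ f x y, w = z ∨ (r w x ∧ r w y))
    (F : Finset α) : ∃ C : Finset α, F ⊆ C ∧ ∀ x ∈ C, ∀ y ∈ C, f x y ⊆ C := by
  classical
  have key : ∀ Q : Multiset α, ∀ P : Finset α, z ∈ P →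
      (∀ x ∈ P, ∀ y ∈ P, ∀ w ∈ f x y, w ∈ P ∨ w ∈ Q) →
      ∃ C : Finset α, P ⊆ C ∧ (∀ x ∈ Q, x ∈ C) ∧ ∀ x ∈ C, ∀ y ∈ C, f x y ⊆ C := by
    intro Q
    induction Q using hr.cutExpand.induction with
    | _ Q ih =>
    intro P hz hP
    rcases Q.empty_or_exists_mem with rfl | ⟨x, hx⟩
    · exact ⟨P, subset_rfl, by simp, fun x hx y hy w hw => by simpa using hP x hx y hy w hw⟩
    obtain ⟨Q, rfl⟩ := Multiset.exists_cons_of_mem hx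
    let T : Finset α := ((insert x P).biUnion fun p => f x p ∪ f p x).filter (· ≠ z)
    have hcut : Relation.CutExpand r (Q + T.val) (x ::ₘ Q) := by
      refine ⟨T.val, x, fun w hw => ?_, ?_⟩
      · simp only [T, Finset.mem_val, Finset.mem_filter, Finset.mem_biUnion,
          Finset.mem_union] at hw
        obtain ⟨⟨p, -, hw | hw⟩, hwz⟩ := hw
        · exact ((h _ _ w hw).resolve_left hwz).1
        · exact ((h _ _ w hw).resolve_left hwz).2
      · rw [← Multiset.singleton_add]
        abel
    have hT : ∀ a ∈ insert x P, ∀ b ∈ insert x P, a = x ∨ b = x → ∀ w ∈ f a b, w ≠ z →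
        w ∈ Q + T.val := by
      intro a ha b hb hab w hw hwz
      refine Multiset.mem_add.2 (Or.inr (Finset.mem_filter.2 ⟨Finset.mem_biUnion.2 ?_, hwz⟩))
      rcases hab with hab | hab <;> rw [hab] at hw
      · exact ⟨b, hb, Finset.mem_union_left _ hw⟩
      · exact ⟨a, ha, Finset.mem_union_right _ hw⟩
    have hxP : ∀ a ∈ insert x P, ∀ b ∈ insert x P, ∀ w ∈ f a b,
        w ∈ insert x P ∨ w ∈ Q + T.val := by
      intro a ha b hb w hw
      by_cases hwz : w = z
      · exact Or.inl (hwz ▸ Finset.mem_insert_of_mem hz)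
      by_cases hab : a = x ∨ b = x
      · exact Or.inr (hT a ha b hb hab w hw hwz)
      rw [not_or] at hab
      rcases hP a (Finset.mem_of_mem_insert_of_ne ha hab.1) b
        (Finset.mem_of_mem_insert_of_ne hb hab.2) w hw with hw | hw
      · exact Or.inl (Finset.mem_insert_of_mem hw)
      rcases Multiset.mem_cons.1 hw with rfl | hw
      · exact Or.inl (Finset.mem_insert_self _ _)
      · exact Or.inr (Multiset.mem_add.2 (Or.inl hw))
    obtain ⟨C, hPC, hQC, hC⟩ := ih (Q + T.val) hcut (insert x P)
      (Finset.mem_insert_of_mem hz) hxP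
    refine ⟨C, (Finset.subset_insert x P).trans hPC, fun y hy => ?_, hC⟩
    rcases Multiset.mem_cons.1 hy with rfl | hy
    · exact hPC (Finset.mem_insert_self _ _)
    · exact hQC y (Multiset.mem_add.2 (Or.inl hy))
  obtain ⟨C, -, hF, hC⟩ := key (F.val + (f z z).val) {z} (Finset.mem_singleton_self z)
    fun x hx y hy w hw => by
      rw [Finset.mem_singleton] at hx hy
      subst hx hy
      exact Or.inr (Multiset.mem_add.2 (Or.inr hw))
  exact ⟨C, fun x hx => hF x (Multiset.mem_add.2 (Or.inl hx)), hC⟩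

end Closure

section Generation

variable {B : Type u} {S : SkewBrace B}

theorem subset_addClosure (X : Set B) : X ⊆ S.addClosure X := fun _ hx _ hT => hT.2 hx

theorem subset_mulClosure (X : Set B) : X ⊆ S.mulClosure X := fun _ hx _ hT => hT.2 hx

theorem addClosure_subset {X T : Set B} (hT : S.IsAddSubgroup T) (h : X ⊆ T) :
    S.addClosure X ⊆ T :=
  Set.sInter_subset_of_mem ⟨hT, h⟩

theorem isAddSubgroup_addClosure (X : Set B) : S.IsAddSubgroup (S.addClosure X) :=
  ⟨fun _ hT => hT.1.1, fun a ha b hb T hT => hT.1.2.1 a (ha T hT) b (hb T hT),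
    fun a ha T hT => hT.1.2.2 a (ha T hT)⟩

theorem isMulSubgroup_mulClosure (X : Set B) : S.IsMulSubgroup (S.mulClosure X) :=
  ⟨fun _ hT => hT.1.1, fun a ha b hb T hT => hT.1.2.1 a (ha T hT) b (hb T hT),
    fun a ha T hT => hT.1.2.2 a (ha T hT)⟩

theorem lam_mem_addClosure_of_star_mem {D : Set B} {a : B}
    (h : ∀ d ∈ D, S.star a d ∈ S.addClosure D) {x : B} (hx : x ∈ S.addClosure D) :
    S.lam a x ∈ S.addClosure D := by
  have hD := S.isAddSubgroup_addClosure D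
  refine addClosure_subset (T := {x | S.lam a x ∈ S.addClosure D}) ⟨?_, ?_, ?_⟩ ?_ hx
  · rw [Set.mem_ofPred_eq, lam_zero]
    exact hD.1
  · intro x hx y hy
    rw [Set.mem_ofPred_eq, lam_add]
    exact hD.2.1 _ hx _ hy
  · intro x hx
    rw [Set.mem_ofPred_eq, lam_neg]
    exact hD.2.2 _ hx
  · intro d hd
    rw [Set.mem_ofPred_eq]
    exact S.star_add a d ▸ hD.2.1 _ (h d hd) _ (subset_addClosure D hd)

theorem lam_mem_addClosure {C D : Set B}
    (h : ∀ c ∈ C, ∀ d ∈ D, S.star c d ∈ S.addClosure D ∧ S.star (S.inv c) d ∈ S.addClosure D)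
    {m : B} (hm : m ∈ S.mulClosure C) {x : B} (hx : x ∈ S.addClosure D) :
    S.lam m x ∈ S.addClosure D := by
  refine (mulClosure_subset (T := {m | ∀ x ∈ S.addClosure D,
    S.lam m x ∈ S.addClosure D ∧ S.lam (S.inv m) x ∈ S.addClosure D}) ⟨?_, ?_, ?_⟩ ?_ hm x hx).1
  · intro x hx
    simpa [inv_zero, zero_lam] using hx
  · intro a ha b hb x hx
    rw [mul_inv_rev, mul_lam, mul_lam]
    exact ⟨(ha _ (hb x hx).1).1, (hb _ (ha x hx).2).2⟩
  · intro a ha x hx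
    rw [inv_inv]
    exact (ha x hx).symm
  · intro c hc x hx
    exact ⟨lam_mem_addClosure_of_star_mem (fun d hd => (h c hc d hd).1) hx,
      lam_mem_addClosure_of_star_mem (fun d hd => (h c hc d hd).2) hx⟩

theorem star_mem_addClosure {C D : Set B}
    (h : ∀ c ∈ C, ∀ d ∈ D, S.star c d ∈ S.addClosure D ∧ S.star (S.inv c) d ∈ S.addClosure D)
    {x : B} (hx : ∀ c ∈ C, S.star c x ∈ S.addClosure D) {m : B} (hm : m ∈ S.mulClosure C) :
    S.star m x ∈ S.addClosure D := by
  have hD := S.isAddSubgroup_addClosure D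
  have hC := S.isMulSubgroup_mulClosure C
  refine (mulClosure_subset (T := {m | m ∈ S.mulClosure C ∧ S.star m x ∈ S.addClosure D})
    ⟨⟨hC.1, ?_⟩, ?_, ?_⟩ ?_ hm).2
  · rw [S.star_eq_zero_iff.2 (S.zero_lam x)]
    exact hD.1
  · rintro a ⟨ha, hax⟩ b ⟨hb, hbx⟩
    refine ⟨hC.2.1 a ha b hb, ?_⟩
    have : S.star (S.mul a b) x = S.add (S.lam a (S.star b x)) (S.star a x) := by
      rw [star, mul_lam, ← S.star_add b x, lam_add, S.add_assoc]
      rfl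
    exact this ▸ hD.2.1 _ (lam_mem_addClosure h ha hbx) _ hax
  · rintro a ⟨ha, hax⟩
    refine ⟨hC.2.2 a ha, ?_⟩
    have : S.star (S.inv a) x = S.neg (S.lam (S.inv a) (S.star a x)) := by
      rw [star, star, lam_add, inv_lam_lam, lam_neg, neg_add_rev, neg_neg]
    exact this ▸ hD.2.2 _ (lam_mem_addClosure h (hC.2.2 a ha) hax)
  · exact fun c hc => ⟨subset_mulClosure C hc, hx c hc⟩

theorem conj_mem_addClosure {D : Set B} {c : B} (h : ∀ d ∈ D, S.addComm d c ∈ S.addClosure D)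
    {x : B} (hx : x ∈ S.addClosure D) :
    S.add (S.neg c) (S.add x c) ∈ S.addClosure D := by
  have hD := S.isAddSubgroup_addClosure D
  refine addClosure_subset (T := {x | S.add (S.neg c) (S.add x c) ∈ S.addClosure D})
    ⟨?_, ?_, ?_⟩ ?_ hx
  · simpa [S.zero_add, S.neg_add] using hD.1
  · intro x hx y hy
    simpa [S.add_assoc, add_neg_cancel_left] using hD.2.1 _ hx _ hy
  · intro x hx
    simpa [S.add_assoc, neg_add_rev, neg_neg] using hD.2.2 _ hx
  · intro d hd
    rw [Set.mem_ofPred_eq]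
    exact S.add_addComm d c ▸ hD.2.1 _ (subset_addClosure D hd) _ (h d hd)

theorem isAddSubgroup_translations (M : Set B) :
    S.IsAddSubgroup {a | ∀ m ∈ M, S.add m a ∈ M ∧ S.add m (S.neg a) ∈ M} := by
  refine ⟨fun m hm => ?_, fun a ha b hb m hm => ?_, fun a ha m hm => ?_⟩
  · simpa [neg_zero, S.add_zero] using hm
  · rw [neg_add_rev, ← S.add_assoc, ← S.add_assoc]
    exact ⟨(hb _ (ha m hm).1).1, (ha _ (hb m hm).2).2⟩
  · rw [neg_neg]
    exact (ha m hm).symm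

/-- A set is closed under `λ`-commutators and additive commutators. -/
def IsCommutatorClosed (S : SkewBrace B) (C : Set B) : Prop :=
  ∀ a ∈ C, ∀ b ∈ C, S.star a b ∈ C ∧ S.star (S.inv a) b ∈ C ∧ S.addComm a b ∈ C

theorem IsCommutatorClosed.add_mem_mulClosure {C : Set B} (hC : S.IsCommutatorClosed C)
    {ρ : B → Ordinal.{v}} (hρ : S.IsCommutatorRank ρ) :
    ∀ c ∈ C, ∀ m ∈ S.mulClosure C,
      S.add m c ∈ S.mulClosure C ∧ S.add m (S.neg c) ∈ S.mulClosure C := by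
  have hM := S.isMulSubgroup_mulClosure C
  intro c
  induction c using (InvImage.wf ρ Ordinal.lt_wf).induction with
  | _ c ih =>
  intro hc m hm
  let D : Set B := {d | d ∈ C ∧ ρ d < ρ c}
  have hD := S.isAddSubgroup_addClosure D
  have hmem : ∀ x ∈ C, x = S.zero ∨ ρ x < ρ c → x ∈ S.addClosure D := by
    rintro x hx (rfl | h)
    · exact hD.1
    · exact subset_addClosure D ⟨hx, h⟩
  have htrans : ∀ a ∈ S.addClosure D, ∀ m ∈ S.mulClosure C,
      S.add m a ∈ S.mulClosure C ∧ S.add m (S.neg a) ∈ S.mulClosure C :=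
    addClosure_subset (isAddSubgroup_translations _) fun d hd => ih d hd.2 hd.1
  have hstar : ∀ m ∈ S.mulClosure C, S.star m c ∈ S.addClosure D := by
    refine fun m hm => star_mem_addClosure (fun b hb d hd => ⟨?_, ?_⟩) (fun b hb => ?_) hm
    · exact hmem _ (hC b hb d hd.1).1 ((hρ b d _ (by tauto)).imp_right fun h => h.2.trans hd.2)
    · exact hmem _ (hC b hb d hd.1).2.1 ((hρ b d _ (by tauto)).imp_right fun h => h.2.trans hd.2)
    · exact hmem _ (hC b hb c hc).1 ((hρ b c _ (by tauto)).imp_right And.right)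
  have hlam : ∀ m ∈ S.mulClosure C, ∃ a ∈ S.addClosure D, S.lam m c = S.add c a := by
    refine fun m hm => ⟨_, conj_mem_addClosure (c := c) (fun d hd => ?_) (hstar m hm), ?_⟩
    · exact hmem _ (hC d hd.1 c hc).2.2 ((hρ d c _ (by tauto)).imp_right And.right)
    · rw [add_neg_cancel_left, star_add]
  have hcM := subset_mulClosure (S := S) C hc
  have hneg : S.neg c ∈ S.mulClosure C := by
    have h : S.neg c = S.add (S.inv c) (S.star (S.inv c) c) := by
      rw [star, ← S.add_assoc, add_lam, S.inv_mul, S.zero_add]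
    exact h ▸ (htrans _ (hstar _ (hM.2.2 c hcM)) _ (hM.2.2 c hcM)).1
  have hinv := hM.2.2 m hm
  constructor
  · obtain ⟨a, ha, h⟩ := hlam _ hinv
    rw [← mul_inv_lam, h]
    exact hM.2.1 _ hm _ (htrans a ha c hcM).1
  · rw [← mul_inv_lam, lam_neg, ← S.star_add (S.inv m) c, neg_add_rev]
    exact hM.2.1 _ hm _ (htrans _ (hstar _ hinv) _ hneg).2

/-- In the presence of a commutator rank, a commutator-closed set multiplicatively generates
a sub-skew brace. -/
theorem IsCommutatorClosed.isSub_mulClosure {C : Set B} (hC : S.IsCommutatorClosed C)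
    {ρ : B → Ordinal.{v}} (hρ : S.IsCommutatorRank ρ) : S.IsSub (S.mulClosure C) := by
  have hM := S.isMulSubgroup_mulClosure C
  have hA := S.isAddSubgroup_addClosure C
  have hlam : ∀ m ∈ S.mulClosure C, ∀ a ∈ S.addClosure C, S.lam m a ∈ S.addClosure C :=
    fun m hm a ha => lam_mem_addClosure (fun c hc d hd =>
      ⟨subset_addClosure C (hC c hc d hd).1, subset_addClosure C (hC c hc d hd).2.1⟩) hm ha
  have hMA : S.mulClosure C ⊆ S.addClosure C := by
    refine fun m hm => (mulClosure_subset
      (T := {m | m ∈ S.mulClosure C ∧ m ∈ S.addClosure C}) ⟨⟨hM.1, hA.1⟩, ?_, ?_⟩ ?_ hm).2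
    · rintro a ⟨ha, ha'⟩ b ⟨hb, hb'⟩
      exact ⟨hM.2.1 a ha b hb, S.add_lam a b ▸ hA.2.1 a ha' _ (hlam a ha b hb')⟩
    · rintro a ⟨ha, ha'⟩
      have := hM.2.2 a ha
      exact ⟨this, S.inv_eq_neg_lam a ▸ hA.2.2 _ (hlam _ this a ha')⟩
    · exact fun c hc => ⟨subset_mulClosure C hc, subset_addClosure C hc⟩
  have htrans := addClosure_subset (isAddSubgroup_translations _) (hC.add_mem_mulClosure hρ)
  refine ⟨hM.1, fun a ha b hb => (htrans (hMA hb) a ha).1, fun a ha => ?_, hM.2.1, hM.2.2⟩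
  exact S.zero_add (S.neg a) ▸ (htrans (hMA ha) _ hM.1).2

/-- If a finite commutator-closed set generates `(B,∘)`, then it lies in a finite term of the
upper annihilator series. -/
theorem IsCommutatorClosed.exists_subset_annSeries {C : Set B} (hC : S.IsCommutatorClosed C)
    (hfin : C.Finite) {ρ : B → Ordinal.{v}} (hρ : S.IsCommutatorRank ρ)
    (hgen : S.mulClosure C = Set.univ) : ∃ n : ℕ, C ⊆ S.annSeries (n : Ordinal.{v}) := by
  have hmono : ∀ {k n : ℕ}, k ≤ n →
      S.annSeries (k : Ordinal.{v}) ⊆ S.annSeries (n : Ordinal.{v}) :=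
    fun h => S.annSeries_mono (Nat.cast_le.2 h)
  have hbdd : ∀ p : B → B → Prop,
      (∀ c ∈ C, ∃ n : ℕ, ∀ x, p c x → x ∈ S.annSeries (n : Ordinal.{v})) →
      ∃ n : ℕ, ∀ c ∈ C, ∀ x, p c x → x ∈ S.annSeries (n : Ordinal.{v}) := by
    intro p hp
    choose! n hn using hp
    obtain ⟨N, hN⟩ := (hfin.image n).bddAbove
    exact ⟨N, fun c hc x hx => hmono (hN ⟨c, hc, rfl⟩) (hn c hc x hx)⟩
  have hrank : ∀ c ∈ C, ∃ n : ℕ, c ∈ S.annSeries (n : Ordinal.{v}) := by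
    intro c
    induction c using (InvImage.wf ρ Ordinal.lt_wf).induction with
    | _ c ih =>
    intro hc
    have hlt : ∀ x ∈ C, x = S.zero ∨ ρ x < ρ c → ∃ n : ℕ, x ∈ S.annSeries (n : Ordinal.{v}) := by
      rintro x hx (rfl | h)
      · exact ⟨0, (S.isIdeal_annSeries _).1.1⟩
      · exact ih x h hx
    obtain ⟨n, hn⟩ := hbdd (fun d x => x = S.star c d ∨ x = S.star d c ∨ x = S.addComm c d) <| by
      intro d hd
      obtain ⟨n₁, h₁⟩ := hlt _ (hC c hc d hd).1 ((hρ c d _ (by tauto)).imp_right And.left)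
      obtain ⟨n₂, h₂⟩ := hlt _ (hC d hd c hc).1 ((hρ d c _ (by tauto)).imp_right And.right)
      obtain ⟨n₃, h₃⟩ := hlt _ (hC c hc d hd).2.2 ((hρ c d _ (by tauto)).imp_right And.left)
      refine ⟨n₁ + n₂ + n₃, ?_⟩
      rintro x (rfl | rfl | rfl)
      · exact hmono (by omega) h₁
      · exact hmono (by omega) h₂
      · exact hmono (by omega) h₃
    refine ⟨n + 1, ?_⟩
    rw [Nat.cast_add_one, annSeries_add_one]
    exact (S.isIdeal_annSeries _).mem_annStep_of_mulClosure_eq_univ hgen fun d hd =>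
      ⟨hn d hd _ (by tauto), hn d hd _ (by tauto), hn d hd _ (by tauto)⟩
  obtain ⟨n, hn⟩ := hbdd (fun c x => x = c) fun c hc => by simpa using hrank c hc
  exact ⟨n, fun c hc => hn c hc c rfl⟩

theorem subGen_subset {X T : Set B} (hT : S.IsSub T) (h : X ⊆ T) : S.subGen X ⊆ T :=
  Set.sInter_subset_of_mem ⟨hT, h⟩

end Generation

end SkewBrace

/-- **Corollary.** Let `B` be a finitely generated skew brace. If `B` is annihilator
hypercentral, then `B` is annihilator nilpotent: `B = Ann_n(B)` for some positive
integer `n`. -/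
theorem annihilator_nilpotent_of_fg_hypercentral {B : Type u} (S : SkewBrace B)
    (hfg : S.FinitelyGenerated)
    (hhc : ∃ o : Ordinal.{u}, S.annSeries o = Set.univ) :
    ∃ n : ℕ, 0 < n ∧ S.annSeries (n : Ordinal.{u}) = Set.univ := by
  classical
  obtain ⟨F, hF⟩ := hfg
  obtain ⟨o, ho⟩ := hhc
  have hρ := SkewBrace.isCommutatorRank_annRank ho
  obtain ⟨C, hFC, hC⟩ := SkewBrace.exists_finset_closed
    (InvImage.wf (S.annRank : B → Ordinal.{u}) Ordinal.lt_wf)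
    (fun a b => {S.star a b, S.star (S.inv a) b, S.addComm a b}) S.zero
    (fun a b w hw => hρ a b w (by simpa using hw)) F
  have hcl : S.IsCommutatorClosed (C : Set B) := fun a ha b hb => by
    have := hC a ha b hb
    simpa [Finset.insert_subset_iff] using this
  have hFC' : (F : Set B) ⊆ C := Finset.coe_subset.2 hFC
  have hgen : S.mulClosure (C : Set B) = Set.univ :=
    Set.univ_subset_iff.1 <| hF ▸ SkewBrace.subGen_subset (hcl.isSub_mulClosure hρ)
      (hFC'.trans (SkewBrace.subset_mulClosure _))
  obtain ⟨n, hn⟩ := hcl.exists_subset_annSeries C.finite_toSet hρ hgen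
  refine ⟨n + 1, n.succ_pos, Set.univ_subset_iff.1 ?_⟩
  rw [← hF]
  exact SkewBrace.subGen_subset (S.isIdeal_annSeries _).isSub
    ((hFC'.trans hn).trans (S.annSeries_mono (Nat.cast_le.2 n.le_succ)))
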